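/- arXiv:1511.07375 — 3 statements merged into one kernel-verified Lean document; each statement's English description precedes it below -/
import Mathlib

section
/- Let K and K̃ be invertible real n×n matrices and let 0 ≤ η < 1 be such that ‖K̃⁻¹b − K⁻¹b‖₂ ≤ η · ‖K⁻¹b‖₂ for every b ∈ ℝⁿ. Then for every nonzero y ∈ ℝⁿ, (1−η)² ≤ ⟨K Kᵀ y, y⟩ / ⟨K̃ K̃ᵀ y, y⟩ ≤ (1+η)². -/
open Matrix

/-- The Euclidean norm on `ℝⁿ`. -/
noncomputable def eNorm {n : ℕ} (x : Fin n → ℝ) : ℝ := Real.sqrt (x ⬝ᵥ x)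

theorem eNorm_eq_norm_toLp {n : ℕ} (x : Fin n → ℝ) :
    eNorm x = ‖WithLp.toLp 2 x‖ := by
  simp [eNorm, EuclideanSpace.norm_eq, dotProduct, sq]

theorem eNorm_nonneg {n : ℕ} (x : Fin n → ℝ) : 0 ≤ eNorm x :=
  Real.sqrt_nonneg _

theorem eNorm_sq {n : ℕ} (x : Fin n → ℝ) : eNorm x ^ 2 = x ⬝ᵥ x :=
  Real.sq_sqrt (Finset.sum_nonneg fun i _ => mul_self_nonneg (x i))

theorem dotProduct_le_eNorm_mul_eNorm {n : ℕ} (x y : Fin n → ℝ) :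
    x ⬝ᵥ y ≤ eNorm x * eNorm y := by
  have h := real_inner_le_norm (WithLp.toLp 2 y) (WithLp.toLp 2 x)
  rw [EuclideanSpace.inner_toLp_toLp, star_trivial] at h
  rw [eNorm_eq_norm_toLp, eNorm_eq_norm_toLp, mul_comm]
  exact h

theorem mul_transpose_mulVec_dotProduct {n : ℕ} (A : Matrix (Fin n) (Fin n) ℝ)
    (y : Fin n → ℝ) : ((A * Aᵀ) *ᵥ y) ⬝ᵥ y = eNorm (Aᵀ *ᵥ y) ^ 2 := by
  rw [eNorm_sq, ← mulVec_mulVec, dotProduct_comm, dotProduct_mulVec, mulVec_transpose]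

/-- A relative error bound for the approximate inverse `B⁻¹` of `A` transfers to the transposes. -/
theorem eNorm_transpose_mulVec_sub_le {n : ℕ} (A B : Matrix (Fin n) (Fin n) ℝ)
    (hA : IsUnit A.det) (hB : IsUnit B.det) (η : ℝ) (hη : 0 ≤ η)
    (h : ∀ b : Fin n → ℝ, eNorm (B⁻¹ *ᵥ b - A⁻¹ *ᵥ b) ≤ η * eNorm (A⁻¹ *ᵥ b))
    (y : Fin n → ℝ) : eNorm (Aᵀ *ᵥ y - Bᵀ *ᵥ y) ≤ η * eNorm (Bᵀ *ᵥ y) := by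
  set x := Aᵀ *ᵥ y - Bᵀ *ᵥ y with hx
  have hEx : eNorm (B⁻¹ *ᵥ (A *ᵥ x) - x) ≤ η * eNorm x := by
    simpa [mulVec_mulVec, nonsing_inv_mul A hA] using h (A *ᵥ x)
  have hdot : x ⬝ᵥ x = (Bᵀ *ᵥ y) ⬝ᵥ (B⁻¹ *ᵥ (A *ᵥ x) - x) := by
    have hBB : B *ᵥ (B⁻¹ *ᵥ (A *ᵥ x)) = A *ᵥ x := by
      rw [mulVec_mulVec, mul_nonsing_inv B hB, one_mulVec]
    nth_rewrite 1 [hx]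
    simp only [mulVec_transpose, sub_dotProduct, ← dotProduct_mulVec, hBB,
      dotProduct_sub]
  have hsq : eNorm x ^ 2 ≤ eNorm (Bᵀ *ᵥ y) * (η * eNorm x) := by
    rw [eNorm_sq, hdot]
    exact (dotProduct_le_eNorm_mul_eNorm _ _).trans
      (mul_le_mul_of_nonneg_left hEx (eNorm_nonneg _))
  rcases (eNorm_nonneg x).eq_or_lt with h0 | hpos
  · rw [← h0]
    exact mul_nonneg hη (eNorm_nonneg _)
  · exact le_of_mul_le_mul_right (by linarith) hpos

/-- **Braess–Peisker conditions.**
If `K` and `K̃` are invertible and the approximate solution `K̃⁻¹ b` satisfies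
`‖K̃⁻¹ b − K⁻¹ b‖₂ ≤ η ‖K⁻¹ b‖₂` for all `b`, with `0 ≤ η < 1`, then for every
nonzero `y` we have `(1−η)² ≤ ⟨K Kᵀ y, y⟩ / ⟨K̃ K̃ᵀ y, y⟩ ≤ (1+η)²`. -/
theorem braess_peisker {n : ℕ} (K Kt : Matrix (Fin n) (Fin n) ℝ)
    (hK : IsUnit K.det) (hKt : IsUnit Kt.det)
    (η : ℝ) (hη0 : 0 ≤ η) (hη1 : η < 1)
    (happrox : ∀ b : Fin n → ℝ,
      eNorm (Kt⁻¹ *ᵥ b - K⁻¹ *ᵥ b) ≤ η * eNorm (K⁻¹ *ᵥ b))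
    (y : Fin n → ℝ) (hy : y ≠ 0) :
    (1 - η) ^ 2 ≤ (((K * Kᵀ) *ᵥ y) ⬝ᵥ y) / (((Kt * Ktᵀ) *ᵥ y) ⬝ᵥ y) ∧
    (((K * Kᵀ) *ᵥ y) ⬝ᵥ y) / (((Kt * Ktᵀ) *ᵥ y) ⬝ᵥ y) ≤ (1 + η) ^ 2 := by
  have hdiff := eNorm_transpose_mulVec_sub_le K Kt hK hKt η hη0 happrox y
  have hz : Ktᵀ *ᵥ y ≠ 0 := fun h => hy <|
    eq_zero_of_mulVec_eq_zero (by rw [det_transpose]; exact hKt.ne_zero) h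
  have hzpos : 0 < eNorm (Ktᵀ *ᵥ y) := by
    rw [eNorm_eq_norm_toLp]
    simpa using hz
  have hupper : eNorm (Kᵀ *ᵥ y) ≤ (1 + η) * eNorm (Ktᵀ *ᵥ y) := by
    have := norm_sub_norm_le (WithLp.toLp 2 (Kᵀ *ᵥ y)) (WithLp.toLp 2 (Ktᵀ *ᵥ y))
    rw [← WithLp.toLp_sub] at this
    simp only [← eNorm_eq_norm_toLp] at this
    linarith
  have hlower : (1 - η) * eNorm (Ktᵀ *ᵥ y) ≤ eNorm (Kᵀ *ᵥ y) := by
    have := norm_sub_norm_le (WithLp.toLp 2 (Ktᵀ *ᵥ y)) (WithLp.toLp 2 (Kᵀ *ᵥ y))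
    rw [norm_sub_rev, ← WithLp.toLp_sub] at this
    simp only [← eNorm_eq_norm_toLp] at this
    linarith
  rw [mul_transpose_mulVec_dotProduct, mul_transpose_mulVec_dotProduct, ← div_pow]
  refine ⟨pow_le_pow_left₀ (by linarith) ((le_div_iff₀ hzpos).2 hlower) 2,
    pow_le_pow_left₀ (div_nonneg (eNorm_nonneg _) hzpos.le) ((div_le_iff₀ hzpos).2 hupper) 2⟩
end

section
/- Let S̃ be a real symmetric positive definite n×n matrix and let L be a real symmetric positive semidefinite n×n matrix with rank(L) = m. Then all eigenvalues of the matrix S̃⁻¹(S̃ + L) are real and greater than or equal to 1, and the eigenvalue 1 has algebraic multiplicity exactly n − m. -/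
open Matrix Polynomial

open scoped MatrixOrder in
theorem Matrix.PosDef.exists_isUnit_conjTranspose_mul_self {ι : Type*} [Fintype ι]
    [DecidableEq ι] {A : Matrix ι ι ℝ} (hA : A.PosDef) :
    ∃ B : Matrix ι ι ℝ, IsUnit B ∧ A = Bᴴ * B := by
  obtain ⟨B, rfl⟩ := CStarAlgebra.nonneg_iff_eq_star_mul_self.mp hA.posSemidef.nonneg
  refine ⟨B, ?_, rfl⟩
  have h := (Matrix.isUnit_iff_isUnit_det _).mp hA.isUnit
  rw [Matrix.det_mul] at h
  exact (Matrix.isUnit_iff_isUnit_det _).mpr (isUnit_of_mul_isUnit_right h)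

/-- The matrix `S⁻¹ (S + L)` has the characteristic polynomial of `K + 1` for a positive
semidefinite matrix `K` congruent to `L`. -/
theorem Matrix.PosDef.exists_posSemidef_charpoly_inv_mul_add {ι : Type*} [Fintype ι]
    [DecidableEq ι] {S L : Matrix ι ι ℝ} (hS : S.PosDef) (hL : L.PosSemidef) :
    ∃ K : Matrix ι ι ℝ, K.PosSemidef ∧ K.rank = L.rank ∧
      (S⁻¹ * (S + L)).charpoly = (K + 1).charpoly := by
  obtain ⟨B, hB, hSB⟩ := hS.inv.exists_isUnit_conjTranspose_mul_self
  have hBdet : IsUnit B.det := (Matrix.isUnit_iff_isUnit_det _).mp hB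
  have hBtdet : IsUnit Bᴴ.det := by
    rw [Matrix.det_conjTranspose]
    exact hBdet.star
  refine ⟨B * L * Bᴴ, hL.mul_mul_conjTranspose_same B, ?_, ?_⟩
  · rw [Matrix.rank_mul_eq_left_of_isUnit_det _ _ hBtdet,
      Matrix.rank_mul_eq_right_of_isUnit_det _ _ hBdet]
  · have hSdet : IsUnit S.det := (Matrix.isUnit_iff_isUnit_det _).mp hS.isUnit
    have h : S⁻¹ * (S + L) = Bᴴ * (B * L + Bᴴ⁻¹) := by
      rw [mul_add, mul_add, Matrix.nonsing_inv_mul _ hSdet, Matrix.mul_nonsing_inv _ hBtdet,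
        hSB, Matrix.mul_assoc, add_comm]
    rw [h, Matrix.charpoly_mul_comm, add_mul, Matrix.nonsing_inv_mul _ hBtdet]

theorem Matrix.IsHermitian.charpoly_add_one {ι : Type*} [Fintype ι] [DecidableEq ι]
    {K : Matrix ι ι ℝ} (hK : K.IsHermitian) :
    (K + 1).charpoly = ∏ i, (X - C (hK.eigenvalues i + 1)) := by
  have h := Matrix.charpoly_sub_scalar K (-1)
  rw [map_neg, map_one, sub_neg_eq_add] at h
  rw [h, hK.charpoly_eq, Polynomial.prod_comp]
  refine Finset.prod_congr rfl fun i _ => ?_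
  simp
  ring

/-- **Spectrum of the preconditioned Schur complement.** If `S̃` is symmetric
positive definite and `L` is symmetric positive semidefinite with `rank L = m`,
then every (complex) eigenvalue of `S̃⁻¹ (S̃ + L)` is real and at least `1`,
and the eigenvalue `1` has algebraic multiplicity exactly `n − m`. -/
theorem preconditioned_schur_spectrum {n m : ℕ}
    (St L : Matrix (Fin n) (Fin n) ℝ)
    (hSt : St.PosDef) (hL : L.PosSemidef) (hrank : L.rank = m)
    (M : Matrix (Fin n) (Fin n) ℝ) (hM : M = St⁻¹ * (St + L)) :
    (∀ μ : ℂ, (M.map (algebraMap ℝ ℂ)).charpoly.IsRoot μ →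
      μ.im = 0 ∧ 1 ≤ μ.re) ∧
    M.charpoly.rootMultiplicity 1 = n - m := by
  obtain ⟨K, hK, hKrank, hchar⟩ := hSt.exists_posSemidef_charpoly_inv_mul_add hL
  rw [← hM, hK.isHermitian.charpoly_add_one] at hchar
  refine ⟨fun μ hμ => ?_, ?_⟩
  · rw [Matrix.charpoly_map, hchar, Polynomial.map_prod, Polynomial.IsRoot,
      Polynomial.eval_prod, Finset.prod_eq_zero_iff] at hμ
    obtain ⟨i, -, hi⟩ := hμ
    have hμ' : μ = ((hK.isHermitian.eigenvalues i + 1 : ℝ) : ℂ) := by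
      rw [← sub_eq_zero]
      simpa using hi
    rw [hμ', Complex.ofReal_im, Complex.ofReal_re]
    exact ⟨rfl, by linarith [hK.eigenvalues_nonneg i]⟩
  · have hcard := Fintype.card_subtype_compl (fun i => hK.isHermitian.eigenvalues i = 0)
    have hle := Fintype.card_subtype_le (fun i => hK.isHermitian.eigenvalues i = 0)
    have hm := hK.isHermitian.rank_eq_card_non_zero_eigs
    have hroots : (∏ i, (X - C (hK.isHermitian.eigenvalues i + 1))).roots =
        Finset.univ.val.map fun i => hK.isHermitian.eigenvalues i + 1 := by
      rw [← Polynomial.roots_multiset_prod_X_sub_C (Finset.univ.val.map _), Multiset.map_map]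
      rfl
    have hcount : M.charpoly.rootMultiplicity 1 =
        Fintype.card {i // hK.isHermitian.eigenvalues i = 0} := by
      rw [← Polynomial.count_roots, hchar, hroots, Multiset.count_map, Fintype.card_subtype]
      simp [Finset.card, eq_comm]
    rw [Fintype.card_fin] at hcard hle
    rw [hcount]
    simp only [ne_eq] at hm
    omega
end

section
/- Let A be a real symmetric positive definite n×n matrix and B a real m×n matrix with rank(B) = m ≤ n. Set M = [A, Bᵀ; B, 0] and P = [A, 0; 0, B·A⁻¹·Bᵀ], both of size (n+m)×(n+m). Then P is invertible and every (complex) eigenvalue μ of P⁻¹M satisfies μ ∈ {1, (1+√5)/2, (1−√5)/2}. -/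
open Matrix Polynomial

/-- An eigenvalue of a matrix is a root of every polynomial that annihilates the matrix. -/
theorem eval_eq_zero_of_isRoot_charpoly {ι K : Type*} [Fintype ι] [DecidableEq ι] [Field K]
    {T : Matrix ι ι K} {p : K[X]} (hp : aeval T p = 0) {μ : K} (hμ : T.charpoly.IsRoot μ) :
    p.eval μ = 0 := by
  have hs : μ ∈ spectrum K T := mem_spectrum_iff_isRoot_charpoly.2 hμ
  have : Nontrivial (Matrix ι ι K) := by
    by_contra h
    rw [not_nontrivial_iff_subsingleton] at h
    simp [spectrum.of_subsingleton] at hs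
  have h := spectrum.subset_polynomial_aeval T p ⟨μ, hs, rfl⟩
  simpa [hp, spectrum.zero_eq] using h

/-- If `Y * X = 1`, the block matrix `[1, X; Y, 0]` is annihilated by `(t - 1) (t² - t - 1)`. -/
theorem fromBlocks_sub_one_mul_eq_zero {k l R : Type*} [Fintype k] [Fintype l] [DecidableEq k]
    [DecidableEq l] [Ring R] {X : Matrix k l R} {Y : Matrix l k R} (h : Y * X = 1) :
    (fromBlocks 1 X Y 0 - 1) *
      (fromBlocks 1 X Y 0 * fromBlocks 1 X Y 0 - fromBlocks 1 X Y 0 - 1) = 0 := by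
  have hYXY : Y * (X * Y) = Y := by rw [← Matrix.mul_assoc, h, Matrix.one_mul]
  rw [← fromBlocks_one]
  simp [-fromBlocks_one, sub_eq_add_neg, fromBlocks_multiply, fromBlocks_neg, fromBlocks_add, h,
    hYXY, Matrix.mul_add]

/-- The Schur complement `B A⁻¹ Bᵀ` is positive definite when `A` is and `B` has full row rank. -/
theorem posDef_mul_inv_mul_transpose {k l : Type*} [Fintype k] [Fintype l] [DecidableEq l]
    {A : Matrix l l ℝ} (hA : A.PosDef) {B : Matrix k l ℝ} (hB : B.rank = Fintype.card k) :
    (B * A⁻¹ * Bᵀ).PosDef := by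
  have hrow : LinearIndependent ℝ B.row := by
    rw [linearIndependent_iff_card_eq_finrank_span, ← hB, B.rank_eq_finrank_span_row, Set.finrank]
  simpa using hA.inv.mul_mul_conjTranspose_same (vecMul_injective_iff.2 hrow)

/-- **Murphy–Golub–Wathen.** For the saddle point matrix `M = [A, Bᵀ; B, 0]`
with `A` symmetric positive definite and `B` of full row rank `m ≤ n`, the
ideal block-diagonal preconditioner `P = blkdiag(A, B A⁻¹ Bᵀ)` is invertible
and the preconditioned matrix `P⁻¹ M` has only the three eigenvalues
`1`, `(1+√5)/2` and `(1−√5)/2`. -/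
theorem ideal_block_diagonal_preconditioner {n m : ℕ} (hmn : m ≤ n)
    (A : Matrix (Fin n) (Fin n) ℝ) (hA : A.PosDef)
    (B : Matrix (Fin m) (Fin n) ℝ) (hB : B.rank = m)
    (M P : Matrix (Fin n ⊕ Fin m) (Fin n ⊕ Fin m) ℝ)
    (hM : M = fromBlocks A Bᵀ B 0)
    (hP : P = fromBlocks A 0 0 (B * A⁻¹ * Bᵀ)) :
    IsUnit P.det ∧
    ∀ μ : ℂ, ((P⁻¹ * M).map (algebraMap ℝ ℂ)).charpoly.IsRoot μ →
      μ = 1 ∨ μ = ((1 + Real.sqrt 5) / 2 : ℝ) ∨ μ = ((1 - Real.sqrt 5) / 2 : ℝ) := by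
  have hAdet : IsUnit A.det := hA.det_pos.ne'.isUnit
  have hSdet : IsUnit (B * A⁻¹ * Bᵀ).det :=
    (posDef_mul_inv_mul_transpose hA (by simpa using hB)).det_pos.ne'.isUnit
  have hPdet : IsUnit P.det := by
    rw [hP, det_fromBlocks_zero₂₁]
    exact hAdet.mul hSdet
  refine ⟨hPdet, fun μ hμ ↦ ?_⟩
  set X := A⁻¹ * Bᵀ with hX
  set Y := (B * A⁻¹ * Bᵀ)⁻¹ * B with hY
  have hYX : Y * X = 1 := by
    rw [hX, hY, Matrix.mul_assoc, ← Matrix.mul_assoc B, nonsing_inv_mul _ hSdet]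
  have hMP : M = P * fromBlocks 1 X Y 0 := by
    simp [hM, hP, hX, hY, fromBlocks_multiply, mul_nonsing_inv_cancel_left _ _ hAdet,
      mul_nonsing_inv_cancel_left _ _ hSdet]
  rw [hMP, nonsing_inv_mul_cancel_left _ _ hPdet] at hμ
  have hT := congrArg (algebraMap ℝ ℂ).mapMatrix (fromBlocks_sub_one_mul_eq_zero hYX)
  simp only [map_mul, map_sub, map_one, map_zero, RingHom.mapMatrix_apply] at hT
  have hroot := eval_eq_zero_of_isRoot_charpoly
    (p := ((Polynomial.X - 1) * (Polynomial.X * Polynomial.X - Polynomial.X - 1) : ℂ[X]))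
    (by simpa only [map_mul, map_sub, map_one, aeval_X] using hT) hμ
  simp only [eval_mul, eval_sub, eval_X, eval_one] at hroot
  have h5 : ((Real.sqrt 5 : ℝ) : ℂ) * (Real.sqrt 5 : ℝ) = 5 := by
    exact_mod_cast Real.mul_self_sqrt (by norm_num : (0 : ℝ) ≤ 5)
  have hfactor : (μ - 1) * ((μ - ((1 + Real.sqrt 5) / 2 : ℝ)) *
      (μ - ((1 - Real.sqrt 5) / 2 : ℝ))) = 0 := by
    push_cast
    linear_combination hroot - (μ - 1) / 4 * h5
  simpa only [mul_eq_zero, sub_eq_zero] using hfactor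
end
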